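/- Let {Y_{k,m}} be an orthonormal basis of spherical harmonics on ℝⁿ (n ≥ 2), and let P be a homogeneous polynomial of degree N on ℝⁿ, written as P(x) = Σ_{2t+k=N} Σ_{m=1}^{a_k} a_{t,k,m} |x|^{2t} Y_{k,m}(x). Let k₀ be the largest k for which a_{t,k,m} ≠ 0 for some t and m. Then N_P := sup{d(P·Y_{k,m}) : k ∈ ℕ₀, 1 ≤ m ≤ a_k} = (N + k₀)/2. -/

import Mathlib

open MeasureTheory Metric MvPolynomial

noncomputable section

/-- `ℝⁿ` as a Euclidean space. -/
abbrev En (n : ℕ) : Type := EuclideanSpace ℝ (Fin n)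

/-- The Laplace operator `Δ = ∂²/∂x₁² + … + ∂²/∂xₙ²` acting on polynomials. -/
def lap (n : ℕ) (P : MvPolynomial (Fin n) ℂ) : MvPolynomial (Fin n) ℂ :=
  ∑ i : Fin n, pderiv i (pderiv i P)

/-- A polynomial is harmonic if `ΔP = 0`. -/
def IsHarmonicPoly (n : ℕ) (P : MvPolynomial (Fin n) ℂ) : Prop := lap n P = 0

/-- The polyharmonic degree `d(P) = min {N : Δ^(N+1) P = 0}`. -/
def pdeg (n : ℕ) (P : MvPolynomial (Fin n) ℂ) : ℕ := sInf {N : ℕ | (lap n)^[N + 1] P = 0}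

/-- Evaluation of a polynomial at a real point of `ℝⁿ`. -/
def evalR {n : ℕ} (P : MvPolynomial (Fin n) ℂ) (x : En n) : ℂ :=
  eval (fun i => (x i : ℂ)) P

/-- Evaluation of a polynomial at `ζθ`, i.e. after substituting `ζ θ i` for `x i`. -/
def evalC {n : ℕ} (P : MvPolynomial (Fin n) ℂ) (ζ : ℂ) (θ : En n) : ℂ :=
  eval (fun i => ζ * (θ i : ℂ)) P

/-- The surface measure on the unit sphere `S^{n-1} ⊂ ℝⁿ`. -/
def sphereMeasure (n : ℕ) : Measure (sphere (0 : En n) 1) :=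
  (volume : Measure (En n)).toSphere

/-- `ω_n`, the surface area of the unit sphere `S^{n-1}`. -/
def omegaN (n : ℕ) : ℝ := ((sphereMeasure n) Set.univ).toReal

/-- The analytic continuation of `ζ ↦ r(ζθ − x)ⁿ = |ζθ − x|ⁿ` to `|ζ| > |x|`
(principal branch; for real `ζ = ρ > |x|` it equals `|ρθ − x|ⁿ`, for `θ` on the
unit sphere). -/
def rPow (n : ℕ) (ζ : ℂ) (θ x : En n) : ℂ :=
  ζ ^ n * (1 - 2 * ((inner ℝ θ x : ℝ) : ℂ) / ζ + ((‖x‖ : ℂ)) ^ 2 / ζ ^ 2) ^ ((n : ℂ) / 2)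

/-- Integral of a complex-valued function against a finite signed measure
(via the Jordan decomposition). -/
def sInt {α : Type*} [MeasurableSpace α] (μ : SignedMeasure α) (f : α → ℂ) : ℂ :=
  ∫ x, f x ∂μ.toJordanDecomposition.posPart - ∫ x, f x ∂μ.toJordanDecomposition.negPart

/-- The support of the signed measure `μ` is contained in the set `s`. -/
def SuppIn {α : Type*} [MeasurableSpace α] (μ : SignedMeasure α) (s : Set α) : Prop :=
  μ.totalVariation sᶜ = 0

/-- The multivariate Markov transform of a finite signed measure. -/
def markov {n : ℕ} (μ : SignedMeasure (En n)) (ζ : ℂ) (θ : En n) : ℂ :=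
  (omegaN n : ℂ)⁻¹ * sInt μ fun x => ζ ^ (n - 1) / rPow n ζ θ x

/-- The multivariate Markov transform of a (nonnegative) measure. -/
def markovM {n : ℕ} (μ : Measure (En n)) (ζ : ℂ) (θ : En n) : ℂ :=
  (omegaN n : ℂ)⁻¹ * ∫ x, ζ ^ (n - 1) / rPow n ζ θ x ∂μ

/-- The function of the second kind `Q_P` for a signed measure. -/
def qP {n : ℕ} (μ : SignedMeasure (En n)) (P : MvPolynomial (Fin n) ℂ) (ζ : ℂ) (θ : En n) : ℂ :=
  (omegaN n : ℂ)⁻¹ * sInt μ fun x => (evalC P ζ θ - evalR P x) * ζ ^ (n - 1) / rPow n ζ θ x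

/-- The function of the second kind `Q_P` for a (nonnegative) measure. -/
def qPM {n : ℕ} (μ : Measure (En n)) (P : MvPolynomial (Fin n) ℂ) (ζ : ℂ) (θ : En n) : ℂ :=
  (omegaN n : ℂ)⁻¹ * ∫ x, (evalC P ζ θ - evalR P x) * ζ ^ (n - 1) / rPow n ζ θ x ∂μ

/-- The rest function `R_P` for a signed measure. -/
def restP {n : ℕ} (μ : SignedMeasure (En n)) (P : MvPolynomial (Fin n) ℂ) (ζ : ℂ) (θ : En n) : ℂ :=
  (omegaN n : ℂ)⁻¹ * sInt μ fun x => evalR P x * ζ ^ (n - 1) / rPow n ζ θ x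
/-- The Laplacian as a linear endomorphism. -/
def lapL (n : ℕ) : Module.End ℂ (MvPolynomial (Fin n) ℂ) :=
  ∑ i : Fin n, (pderiv i).toLinearMap ∘ₗ (pderiv i).toLinearMap

lemma lapL_apply (n : ℕ) (P : MvPolynomial (Fin n) ℂ) : lapL n P = lap n P := by
  simp [lapL, lap, LinearMap.sum_apply]

lemma lapL_def (n : ℕ) (P : MvPolynomial (Fin n) ℂ) :
    lapL n P = ∑ i : Fin n, pderiv i (pderiv i P) := lapL_apply n P

lemma lap_iterate (n s : ℕ) (P : MvPolynomial (Fin n) ℂ) :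
    (lap n)^[s] P = (lapL n ^ s) P := by
  rw [Module.End.pow_apply]
  congr 1
  congr 1
  funext Q
  exact (lapL_apply n Q).symm

/-- The polynomial `|x|²`. -/
def rsq (n : ℕ) : MvPolynomial (Fin n) ℂ := ∑ i : Fin n, X i ^ 2

lemma pow_succ_lapL (n s : ℕ) (P : MvPolynomial (Fin n) ℂ) :
    (lapL n ^ (s + 1)) P = (lapL n ^ s) (lapL n P) := by
  rw [pow_succ]; rfl

lemma pow_lapL_eq_zero_of_le {n s t : ℕ} (h : s ≤ t) {P : MvPolynomial (Fin n) ℂ}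
    (hP : (lapL n ^ s) P = 0) : (lapL n ^ t) P = 0 := by
  obtain ⟨u, rfl⟩ := Nat.exists_eq_add_of_le h
  rw [add_comm, pow_add, Module.End.mul_apply, hP, map_zero]

lemma pderiv_pderiv_comm {n : ℕ} (i j : Fin n) (P : MvPolynomial (Fin n) ℂ) :
    pderiv i (pderiv j P) = pderiv j (pderiv i P) := by
  ext m
  simp only [coeff_pderiv]
  by_cases h : i = j
  · subst h; rfl
  · have h' : j ≠ i := fun e => h e.symm
    simp [Finsupp.single_apply, h, h', add_right_comm]
    ring

lemma lapL_pderiv {n : ℕ} (i : Fin n) (P : MvPolynomial (Fin n) ℂ) :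
    lapL n (pderiv i P) = pderiv i (lapL n P) := by
  simp only [lapL_def, map_sum]
  refine Finset.sum_congr rfl fun j _ => ?_
  rw [pderiv_pderiv_comm j i, pderiv_pderiv_comm j i]

lemma lapL_mul {n : ℕ} (P Q : MvPolynomial (Fin n) ℂ) :
    lapL n (P * Q) = lapL n P * Q + P * lapL n Q
      + (2 : ℂ) • ∑ i : Fin n, pderiv i P * pderiv i Q := by
  simp only [lapL_def, Finset.sum_mul, Finset.mul_sum, Finset.smul_sum, ← Finset.sum_add_distrib]
  refine Finset.sum_congr rfl fun j _ => ?_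
  simp only [pderiv_mul, map_add, two_smul]
  ring

lemma pderiv_rsq {n : ℕ} (i : Fin n) : pderiv i (rsq n) = (2 : ℂ) • X i := by
  classical
  simp only [rsq, map_sum, pderiv_pow]
  rw [Finset.sum_eq_single i]
  · simp only [pderiv_X_self, mul_one, MvPolynomial.smul_eq_C_mul, map_ofNat]
    simp
  · intro j _ hj
    rw [pderiv_X_of_ne hj, mul_zero]
  · simp

lemma lapL_rsq (n : ℕ) : lapL n (rsq n) = C (2 * (n : ℂ)) := by
  simp only [lapL_def, pderiv_rsq, Derivation.map_smul, pderiv_X_self]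
  simp [MvPolynomial.smul_eq_C_mul, mul_comm]

lemma lapL_rsq_mul {n d : ℕ} {P : MvPolynomial (Fin n) ℂ} (hP : P.IsHomogeneous d) :
    lapL n (rsq n * P) = rsq n * lapL n P + ((4 * d + 2 * n : ℝ) : ℂ) • P := by
  rw [lapL_mul, lapL_rsq]
  simp only [pderiv_rsq, smul_mul_assoc, ← Finset.smul_sum, hP.sum_X_mul_pderiv]
  simp only [MvPolynomial.smul_eq_C_mul, nsmul_eq_mul]
  push_cast
  simp only [map_add, map_mul, map_natCast, map_ofNat]
  ring

lemma isHomogeneous_lapL {n d : ℕ} {P : MvPolynomial (Fin n) ℂ} (hP : P.IsHomogeneous d) :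
    (lapL n P).IsHomogeneous (d - 2) := by
  rw [lapL_def]
  exact IsHomogeneous.sum _ _ _ fun i _ => hP.pderiv.pderiv

lemma isHomogeneous_rsq (n : ℕ) : (rsq n).IsHomogeneous 2 :=
  IsHomogeneous.sum _ _ _ fun i _ => isHomogeneous_X_pow i 2

lemma pow_lapL_rsq_mul {n : ℕ} (s : ℕ) : ∀ {d : ℕ} {P : MvPolynomial (Fin n) ℂ},
    P.IsHomogeneous d → (lapL n ^ s) P = 0 → (lapL n ^ (s + 1)) (rsq n * P) = 0 := by
  induction s with
  | zero =>
    intro d P _ h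
    have : P = 0 := by simpa using h
    simp [this]
  | succ s ih =>
    intro d P hP h
    rw [pow_succ_lapL, lapL_rsq_mul hP, map_add, map_smul, h, smul_zero, add_zero]
    exact ih (isHomogeneous_lapL hP) (by rw [← pow_succ_lapL]; exact h)

lemma pow_lapL_rsq_pow_mul {n : ℕ} (s t : ℕ) {d : ℕ} {P : MvPolynomial (Fin n) ℂ}
    (hP : P.IsHomogeneous d) (h : (lapL n ^ s) P = 0) :
    (lapL n ^ (s + t)) (rsq n ^ t * P) = 0 := by
  induction t with
  | zero => simpa using h
  | succ t ih =>
    rw [pow_succ', mul_assoc]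
    exact pow_lapL_rsq_mul (s + t) (((isHomogeneous_rsq n).pow t).mul hP) ih

lemma pow_lapL_rsq_mul_pos {n : ℕ} (hn : 0 < n) (s : ℕ) : ∀ {P : MvPolynomial (Fin n) ℂ} {r : ℝ},
    P.IsHomogeneous (2 * s) → 0 < r → (lapL n ^ s) P = C (r : ℂ) →
    ∃ r' : ℝ, 0 < r' ∧ (lapL n ^ (s + 1)) (rsq n * P) = C (r' : ℂ) := by
  have hn' : (0 : ℝ) < n := by exact_mod_cast hn
  induction s with
  | zero =>
    intro P r hP hr h
    have hPC : P = C (r : ℂ) := by simpa using h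
    refine ⟨(4 * ((2 * 0 : ℕ) : ℝ) + 2 * n) * r, by positivity, ?_⟩
    rw [pow_succ_lapL, lapL_rsq_mul hP, pow_zero]
    have : lapL n P = 0 := by simp [lapL_def, hPC]
    rw [this, hPC, mul_zero, zero_add, smul_eq_C_mul, ← C_mul]
    simp
  | succ s ih =>
    intro P r hP hr h
    obtain ⟨r', hr', e⟩ := ih (P := lapL n P) (r := r) (isHomogeneous_lapL hP) hr
      (by rw [← pow_succ_lapL]; exact h)
    refine ⟨r' + (4 * ((2 * (s + 1) : ℕ) : ℝ) + 2 * n) * r, by positivity, ?_⟩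
    rw [pow_succ_lapL, lapL_rsq_mul hP, map_add, map_smul, h, e, smul_eq_C_mul, ← C_mul, ← C_add]
    push_cast
    rfl

lemma pow_lapL_rsq_pow_mul_pos {n : ℕ} (hn : 0 < n) (s t : ℕ) {P : MvPolynomial (Fin n) ℂ} {r : ℝ}
    (hP : P.IsHomogeneous (2 * s)) (hr : 0 < r) (h : (lapL n ^ s) P = C (r : ℂ)) :
    ∃ r' : ℝ, 0 < r' ∧ (lapL n ^ (s + t)) (rsq n ^ t * P) = C (r' : ℂ) := by
  induction t with
  | zero => exact ⟨r, hr, by simpa using h⟩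
  | succ t ih =>
    obtain ⟨r', hr', e⟩ := ih
    rw [pow_succ', mul_assoc]
    refine pow_lapL_rsq_mul_pos hn (s + t) ?_ hr' e
    have := ((isHomogeneous_rsq n).pow t).mul hP
    rwa [← mul_add, add_comm t s] at this

/-- The product of a harmonic polynomial of degree `j` and a harmonic polynomial. -/
lemma pow_lapL_mul_harmonic {n : ℕ} (j : ℕ) : ∀ {P Q : MvPolynomial (Fin n) ℂ},
    P.IsHomogeneous j → lapL n P = 0 → lapL n Q = 0 → (lapL n ^ (j + 1)) (P * Q) = 0 := by
  induction j with
  | zero =>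
    intro P Q hP hP0 hQ0
    have hPC : P = C (coeff 0 P) := by
      rw [← totalDegree_zero_iff_isHomogeneous] at hP
      exact totalDegree_eq_zero_iff_eq_C.1 hP
    rw [pow_succ_lapL, lapL_mul, hP0, hQ0, hPC]
    simp
  | succ j ih =>
    intro P Q hP hP0 hQ0
    rw [pow_succ_lapL, lapL_mul, hP0, hQ0, zero_mul, mul_zero, zero_add, zero_add, map_smul,
      map_sum]
    rw [Finset.sum_eq_zero, smul_zero]
    intro i _
    exact ih hP.pderiv (by rw [lapL_pderiv, hP0, map_zero]) (by rw [lapL_pderiv, hQ0, map_zero])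

/-- Coefficientwise conjugation. -/
def cj {n : ℕ} (P : MvPolynomial (Fin n) ℂ) : MvPolynomial (Fin n) ℂ :=
  MvPolynomial.map (starRingEnd ℂ) P

lemma lapL_cj {n : ℕ} {P : MvPolynomial (Fin n) ℂ} (h : lapL n P = 0) : lapL n (cj P) = 0 := by
  have : lapL n (cj P) = cj (lapL n P) := by
    simp [lapL_def, cj, pderiv_map]
  rw [this, h]; simp [cj]

lemma pow_lapL_mul_cj {n : ℕ} (k : ℕ) : ∀ {P : MvPolynomial (Fin n) ℂ},
    P.IsHomogeneous k → lapL n P = 0 →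
    ∃ r : ℝ, 0 ≤ r ∧ (P ≠ 0 → 0 < r) ∧ (lapL n ^ k) (P * cj P) = C (r : ℂ) := by
  induction k with
  | zero =>
    intro P hP hP0
    have hPC : P = C (coeff 0 P) := by
      rw [← totalDegree_zero_iff_isHomogeneous] at hP
      exact totalDegree_eq_zero_iff_eq_C.1 hP
    generalize coeff 0 P = z at hPC
    subst hPC
    refine ⟨Complex.normSq z, Complex.normSq_nonneg z, ?_, ?_⟩
    · intro h
      refine Complex.normSq_pos.2 fun h0 => h (by simp [h0])
    · simp only [cj, map_C, pow_zero, Module.End.one_apply]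
      rw [← C_mul, Complex.mul_conj]
  | succ k ih =>
    intro P hP hP0
    have key := fun i : Fin n => ih (P := pderiv i P) hP.pderiv
      (by rw [lapL_pderiv, hP0, map_zero])
    choose r h0 hpos e using key
    refine ⟨2 * ∑ i, r i, by have := Finset.sum_nonneg fun i (_ : i ∈ Finset.univ) => h0 i; positivity, ?_, ?_⟩
    · intro hne
      have : ∃ i, pderiv i P ≠ 0 := by
        by_contra! hall
        have hE := hP.sum_X_mul_pderiv
        simp only [hall, mul_zero, Finset.sum_const_zero] at hE
        exact hne ((smul_eq_zero.1 hE.symm).resolve_left (by omega))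
      obtain ⟨i, hi⟩ := this
      have : 0 < ∑ i, r i := Finset.sum_pos' (fun i _ => h0 i) ⟨i, Finset.mem_univ i, hpos i hi⟩
      positivity
    · rw [pow_succ_lapL, lapL_mul, hP0, lapL_cj hP0, zero_mul, mul_zero, zero_add, zero_add,
        map_smul, map_sum]
      have : ∀ i, (lapL n ^ k) (pderiv i P * pderiv i (cj P)) = C ((r i : ℝ) : ℂ) := by
        intro i
        rw [← e i, cj, cj, pderiv_map]
      simp only [this]
      rw [smul_eq_C_mul]
      push_cast
      simp [map_sum]

lemma continuous_evalR {n : ℕ} (P : MvPolynomial (Fin n) ℂ) :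
    Continuous fun θ : sphere (0 : En n) 1 => evalR P (θ : En n) := by
  have h : Continuous fun θ : sphere (0 : En n) 1 => (fun i => (((θ : En n) i : ℝ) : ℂ)) := by
    fun_prop
  exact (MvPolynomial.continuous_eval P).comp h

lemma sum_smul_ne_zero {n a : ℕ} (Y : Fin a → MvPolynomial (Fin n) ℂ)
    (hYon : ∀ (m m' : Fin a),
      ∫ θ : sphere (0 : En n) 1, evalR (Y m) (θ : En n) *
        (starRingEnd ℂ) (evalR (Y m') (θ : En n)) ∂(sphereMeasure n)
      = if m = m' then 1 else 0)
    (c : Fin a → ℂ) (m₀ : Fin a) (hc : c m₀ ≠ 0) : ∑ m, c m • Y m ≠ 0 := by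
  intro h
  haveI : IsFiniteMeasure (sphereMeasure n) := by unfold sphereMeasure; infer_instance
  apply hc
  have h1 : ∫ θ : sphere (0 : En n) 1, ∑ m, c m * (evalR (Y m) (θ : En n) *
        (starRingEnd ℂ) (evalR (Y m₀) (θ : En n))) ∂(sphereMeasure n) = c m₀ := by
    rw [integral_finsetSum]
    · simp only [integral_const_mul, hYon]
      simp
    · intro m _
      apply Continuous.integrable_of_hasCompactSupport
      · have h1 := continuous_evalR (Y m)
        have h2 := continuous_evalR (Y m₀)
        exact continuous_const.mul (h1.mul (Complex.continuous_conj.comp h2))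
      · exact HasCompactSupport.of_compactSpace _
  rw [← h1]
  have : ∀ θ : sphere (0 : En n) 1, ∑ m, c m * (evalR (Y m) (θ : En n) *
        (starRingEnd ℂ) (evalR (Y m₀) (θ : En n))) = 0 := by
    intro θ
    simp only [← mul_assoc]
    rw [← Finset.sum_mul]
    have : evalR (∑ m, c m • Y m) (θ : En n) = 0 := by rw [h]; simp [evalR]
    simp only [evalR, map_sum, smul_eval] at this
    simp only [evalR, this, zero_mul]
  simp only [this, integral_zero]

/-- If the homogeneous polynomial `P` of degree `N` has Gauss
decomposition `P = Σ_{2t+k=N} Σ_m a_{t,k,m} |x|^{2t} Y_{k,m}` and `k₀` is the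
largest `k` appearing with a nonzero coefficient, then
`N_P = sup_{k,m} d(P·Y_{k,m}) = (N + k₀)/2`. -/
theorem NP_of_homogeneous_eq
    (n : ℕ) (hn : 2 ≤ n)
    (a : ℕ → ℕ) (Y : (k : ℕ) → Fin (a k) → MvPolynomial (Fin n) ℂ)
    (hYhom : ∀ (k : ℕ) (m : Fin (a k)), (Y k m).IsHomogeneous k)
    (hYharm : ∀ (k : ℕ) (m : Fin (a k)), IsHarmonicPoly n (Y k m))
    (hYon : ∀ (k : ℕ) (m m' : Fin (a k)),
      ∫ θ : sphere (0 : En n) 1, evalR (Y k m) (θ : En n) *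
        (starRingEnd ℂ) (evalR (Y k m') (θ : En n)) ∂(sphereMeasure n)
      = if m = m' then 1 else 0)
    (hYbasis : ∀ (k : ℕ) (Q : MvPolynomial (Fin n) ℂ), Q.IsHomogeneous k →
      IsHarmonicPoly n Q → ∃ c : Fin (a k) → ℂ, Q = ∑ m, c m • Y k m)
    (N : ℕ) (P : MvPolynomial (Fin n) ℂ) (hPhom : P.IsHomogeneous N)
    (c : (t : ℕ) → Fin (a (N - 2 * t)) → ℂ)
    (hP : P = ∑ t ∈ Finset.range (N / 2 + 1), ∑ m : Fin (a (N - 2 * t)),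
      c t m • ((∑ i : Fin n, (X i : MvPolynomial (Fin n) ℂ) ^ 2) ^ t * Y (N - 2 * t) m))
    (t₀ : ℕ) (ht₀ : t₀ ≤ N / 2) (m₀ : Fin (a (N - 2 * t₀))) (hc₀ : c t₀ m₀ ≠ 0)
    (hmax : ∀ t : ℕ, ∀ m : Fin (a (N - 2 * t)), t < t₀ → c t m = 0)
    (k₀ : ℕ) (hk₀ : k₀ = N - 2 * t₀) :
    2 * sSup {d : ℕ | ∃ (k : ℕ) (m : Fin (a k)), pdeg n (P * Y k m) = d}
      = N + k₀ := by
  have hR : (∑ i : Fin n, (X i : MvPolynomial (Fin n) ℂ) ^ 2) = rsq n := rfl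
  rw [hR] at hP
  have hharm : ∀ k m, lapL n (Y k m) = 0 := fun k m => by rw [lapL_apply]; exact hYharm k m
  set D := N - t₀ with hD
  -- each term has polyharmonic degree at most `N - t`
  have term : ∀ (Q : MvPolynomial (Fin n) ℂ) (e : ℕ), Q.IsHomogeneous e → lapL n Q = 0 →
      ∀ t ≤ N / 2, ∀ m : Fin (a (N - 2 * t)),
      (lapL n ^ (N - t + 1)) ((rsq n ^ t * Y (N - 2 * t) m) * Q) = 0 := by
    intro Q e hQ hQ0 t ht m
    have h1 := pow_lapL_mul_harmonic (N - 2 * t) (hYhom _ m) (hharm _ m) hQ0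
    have h2 := pow_lapL_rsq_pow_mul _ t ((hYhom _ m).mul hQ) h1
    rw [mul_assoc, show N - t + 1 = N - 2 * t + 1 + t by omega]
    exact h2
  have expand : ∀ (Q : MvPolynomial (Fin n) ℂ) (s : ℕ), (lapL n ^ s) (P * Q) =
      ∑ t ∈ Finset.range (N / 2 + 1), ∑ m : Fin (a (N - 2 * t)),
        c t m • (lapL n ^ s) ((rsq n ^ t * Y (N - 2 * t) m) * Q) := by
    intro Q s
    rw [hP]
    simp only [Finset.sum_mul, map_sum, smul_mul_assoc, map_smul]
  have upper : ∀ k m, (lapL n ^ (D + 1)) (P * Y k m) = 0 := by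
    intro k m
    rw [expand]
    refine Finset.sum_eq_zero fun t ht => Finset.sum_eq_zero fun m' _ => ?_
    have ht' : t ≤ N / 2 := by have := Finset.mem_range.1 ht; omega
    by_cases hlt : t < t₀
    · rw [hmax t m' hlt, zero_smul]
    · rw [pow_lapL_eq_zero_of_le (by omega) (term _ k (hYhom k m) (hharm k m) t ht' m'), smul_zero]
  -- the leading harmonic component
  set H : MvPolynomial (Fin n) ℂ := ∑ m, c t₀ m • Y (N - 2 * t₀) m with hH
  have hHne : H ≠ 0 := sum_smul_ne_zero _ (hYon (N - 2 * t₀)) (c t₀) m₀ hc₀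
  have hHhom : H.IsHomogeneous (N - 2 * t₀) :=
    IsHomogeneous.sum _ _ _ fun m _ => by
      rw [smul_eq_C_mul]
      simpa using (isHomogeneous_C (Fin n) (c t₀ m)).mul (hYhom _ m)
  have hHharm : lapL n H = 0 := by simp [hH, hharm]
  have hcjhom : (cj H).IsHomogeneous (N - 2 * t₀) := hHhom.map _
  have lower : (lapL n ^ D) (P * cj H) ≠ 0 := by
    obtain ⟨r, -, hr, er⟩ := pow_lapL_mul_cj _ hHhom hHharm
    obtain ⟨r', hr', er'⟩ := pow_lapL_rsq_pow_mul_pos (by omega) _ t₀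
      (by rw [two_mul]; exact hHhom.mul hcjhom) (hr hHne) er
    have : (lapL n ^ D) (P * cj H) = C (r' : ℂ) := by
      rw [expand, Finset.sum_eq_single t₀]
      · rw [← er', show D = N - 2 * t₀ + t₀ by omega]
        simp only [← map_smul, ← map_sum]
        congr 1
        generalize cj H = G
        simp only [hH, Finset.sum_mul, Finset.mul_sum, smul_mul_assoc, mul_smul_comm, mul_assoc]
      · intro t ht hne
        have ht' : t ≤ N / 2 := by have := Finset.mem_range.1 ht; omega
        refine Finset.sum_eq_zero fun m' _ => ?_
        by_cases hlt : t < t₀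
        · rw [hmax t m' hlt, zero_smul]
        · rw [pow_lapL_eq_zero_of_le (by omega) (term _ _ hcjhom (lapL_cj hHharm) t ht' m'),
            smul_zero]
      · intro h
        exact absurd (Finset.mem_range.2 (by omega)) h
    rw [this]
    intro h0
    have := (C_eq_zero (σ := Fin n)).1 h0
    exact hr'.ne' (by exact_mod_cast this)
  have ex : ∃ m, (lapL n ^ D) (P * Y (N - 2 * t₀) m) ≠ 0 := by
    by_contra! hall
    obtain ⟨b, hb⟩ := hYbasis (N - 2 * t₀) (cj H) hcjhom
      (by rw [IsHarmonicPoly, ← lapL_apply]; exact lapL_cj hHharm)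
    apply lower
    rw [hb]
    simp [Finset.mul_sum, hall]
  have pdeg_le : ∀ k m, pdeg n (P * Y k m) ≤ D := by
    intro k m
    refine Nat.sInf_le ?_
    change (lap n)^[D + 1] _ = 0
    rw [lap_iterate]; exact upper k m
  obtain ⟨m₁, hm₁⟩ := ex
  have attained : pdeg n (P * Y (N - 2 * t₀) m₁) = D := by
    refine le_antisymm (pdeg_le _ _) ?_
    by_contra! hlt
    have hmem : pdeg n (P * Y (N - 2 * t₀) m₁) ∈
        {M : ℕ | (lap n)^[M + 1] (P * Y (N - 2 * t₀) m₁) = 0} :=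
      Nat.sInf_mem ⟨D, by change (lap n)^[D + 1] _ = 0; rw [lap_iterate]; exact upper _ _⟩
    change (lap n)^[_ + 1] _ = 0 at hmem
    rw [lap_iterate] at hmem
    exact hm₁ (pow_lapL_eq_zero_of_le hlt hmem)
  have hsup : IsGreatest {d : ℕ | ∃ (k : ℕ) (m : Fin (a k)), pdeg n (P * Y k m) = d} D := by
    refine ⟨⟨_, m₁, attained⟩, ?_⟩
    rintro d ⟨k, m, rfl⟩
    exact pdeg_le k m
  rw [hsup.csSup_eq, hk₀]
  omega
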